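/- Let p ∈ ℤ[X] be irreducible of degree 1 with positive leading coefficient, and let A, B, C, D ∈ ℤ[X] each have positive leading coefficient, with deg B ≤ deg A, p not dividing A·B·C·D, and 4ABCD = p(A + B) + C. Then the tuple (deg A, deg B, deg C, deg D) is one of (0,0,0,1), (1,0,0,1), (1,0,1,0), (2,1,0,0). -/

import Mathlib

open Polynomial

theorem natDegree_add_of_leadingCoeff_pos {R : Type*} [Semiring R] [PartialOrder R]
    [IsOrderedCancelAddMonoid R] {P Q : R[X]} (hP : 0 < P.leadingCoeff)
    (hQ : 0 < Q.leadingCoeff) : (P + Q).natDegree = max P.natDegree Q.natDegree :=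
  natDegree_eq_of_degree_eq_some <| by
    rw [degree_add_eq_of_leadingCoeff_add_ne_zero (add_pos hP hQ).ne',
      degree_eq_natDegree (leadingCoeff_ne_zero.1 hP.ne'),
      degree_eq_natDegree (leadingCoeff_ne_zero.1 hQ.ne')]
    rfl

theorem leadingCoeff_add_pos {R : Type*} [Semiring R] [PartialOrder R]
    [IsOrderedCancelAddMonoid R] {P Q : R[X]} (hP : 0 < P.leadingCoeff)
    (hQ : 0 < Q.leadingCoeff) : 0 < (P + Q).leadingCoeff := by
  rcases lt_trichotomy P.degree Q.degree with h | h | h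
  · rwa [leadingCoeff_add_of_degree_lt h]
  · rw [leadingCoeff_add_of_degree_eq h (add_pos hP hQ).ne']
    exact add_pos hP hQ
  · rwa [leadingCoeff_add_of_degree_lt' h]

/-- An integer polynomial with no real zeros has no linear factor. -/
theorem mul_ne_of_natDegree_eq_one {P Q F : ℤ[X]} (hP : P.natDegree = 1)
    (hF : ∀ x : ℝ, F.aeval x ≠ 0) : P * Q ≠ F := by
  rintro rfl
  have hdeg : (P.map (Int.castRingHom ℝ)).degree = 1 := by
    rw [degree_map_eq_of_injective (RingHom.injective_int _)]
    exact (degree_eq_iff_natDegree_eq_of_pos one_pos).2 hP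
  obtain ⟨x, hx⟩ := exists_root_of_degree_eq_one hdeg
  apply hF x
  have hPx : P.aeval x = 0 := by
    rw [aeval_def, ← eval_map]
    exact hx
  rw [map_mul, hPx, zero_mul]

/-- The factorization `(N * A - p) * (N * B - p) = p ^ 2 + N * C` with `N * C` a positive
constant rules out linear `A` and `B`. -/
theorem not_linear_pair {p A B N C : ℤ[X]} (hp : p.natDegree = 1)
    (hA : A.natDegree = 1) (hB : B.natDegree = 1)
    (hN : 0 < N.leadingCoeff) (hC : 0 < C.leadingCoeff)
    (hN0 : N.natDegree = 0) (hC0 : C.natDegree = 0) :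
    N * A * B ≠ p * (A + B) + C := by
  intro h
  obtain ⟨n, rfl⟩ := natDegree_eq_zero.1 hN0
  obtain ⟨c, rfl⟩ := natDegree_eq_zero.1 hC0
  rw [leadingCoeff_C] at hN hC
  have hfac : (C n * A - p) * (C n * B - p) = p ^ 2 + C (n * c) := by
    rw [C_mul]
    linear_combination C n * h
  have hsq : (p ^ 2 + C (n * c)).natDegree = 2 := by
    rw [natDegree_add_C, natDegree_pow, hp]
  have hle : ∀ {Q : ℤ[X]}, Q.natDegree = 1 → (C n * Q - p).natDegree ≤ 1 := fun hQ =>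
    (natDegree_sub_le _ _).trans
      (max_le ((natDegree_C_mul_le _ _).trans hQ.le) hp.le)
  have hone : (C n * A - p).natDegree = 1 := by
    have hmul := natDegree_mul_le (p := C n * A - p) (q := C n * B - p)
    rw [hfac, hsq] at hmul
    have := hle hA
    have := hle hB
    omega
  refine mul_ne_of_natDegree_eq_one hone (fun x => ?_) hfac
  have hnc : (0 : ℝ) < (n * c : ℤ) := Int.cast_pos.2 (mul_pos hN hC)
  rw [map_add, map_pow, aeval_C]
  simp only [algebraMap_int_eq, eq_intCast]
  positivity

theorem stmt_10 (p A B C D : Polynomial ℤ)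
    (hp : Irreducible p) (hpdeg : p.natDegree = 1) (hplead : 0 < p.leadingCoeff)
    (hA : 0 < A.leadingCoeff) (hB : 0 < B.leadingCoeff)
    (hC : 0 < C.leadingCoeff) (hD : 0 < D.leadingCoeff)
    (hBA : B.natDegree ≤ A.natDegree)
    (hndvd : ¬ p ∣ A * B * C * D)
    (heq : 4 * A * B * C * D = p * (A + B) + C) :
    (A.natDegree = 0 ∧ B.natDegree = 0 ∧ C.natDegree = 0 ∧ D.natDegree = 1) ∨
    (A.natDegree = 1 ∧ B.natDegree = 0 ∧ C.natDegree = 0 ∧ D.natDegree = 1) ∨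
    (A.natDegree = 1 ∧ B.natDegree = 0 ∧ C.natDegree = 1 ∧ D.natDegree = 0) ∨
    (A.natDegree = 2 ∧ B.natDegree = 1 ∧ C.natDegree = 0 ∧ D.natDegree = 0) := by
  have hA0 := leadingCoeff_ne_zero.1 hA.ne'
  have hB0 := leadingCoeff_ne_zero.1 hB.ne'
  have hC0 := leadingCoeff_ne_zero.1 hC.ne'
  have hD0 := leadingCoeff_ne_zero.1 hD.ne'
  have hAB := leadingCoeff_add_pos hA hB
  have hAB0 := leadingCoeff_ne_zero.1 hAB.ne'
  have h4 : (4 : ℤ[X]).natDegree = 0 := natDegree_ofNat 4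
  have h4lead : (4 : ℤ[X]).leadingCoeff = 4 := by
    rw [← C_ofNat, leadingCoeff_C]
  have h40 : (4 : ℤ[X]) ≠ 0 := leadingCoeff_ne_zero.1 (by rw [h4lead]; norm_num)
  have h4A0 := mul_ne_zero h40 hA0
  have h4AB0 := mul_ne_zero h4A0 hB0
  have hsum : A.natDegree + B.natDegree + C.natDegree + D.natDegree =
      max (1 + A.natDegree) C.natDegree := by
    have h := congrArg natDegree heq
    rwa [natDegree_add_of_leadingCoeff_pos (by rw [leadingCoeff_mul]; positivity) hC,
      natDegree_mul hp.ne_zero hAB0, natDegree_add_of_leadingCoeff_pos hA hB,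
      max_eq_left hBA, hpdeg, natDegree_mul (mul_ne_zero h4AB0 hC0) hD0,
      natDegree_mul h4AB0 hC0, natDegree_mul h4A0 hB0, natDegree_mul h40 hA0, h4, zero_add] at h
  have hAle : A.natDegree ≤ max (1 + B.natDegree) C.natDegree := by
    have hpB : 0 < (p * B).leadingCoeff := by rw [leadingCoeff_mul]; positivity
    have hdvd : A ∣ p * B + C := ⟨4 * B * C * D - p, by linear_combination -heq⟩
    have h := natDegree_le_of_dvd hdvd
      (leadingCoeff_ne_zero.1 (leadingCoeff_add_pos hpB hC).ne')
    rwa [natDegree_add_of_leadingCoeff_pos hpB hC, natDegree_mul hp.ne_zero hB0,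
      hpdeg] at h
  have hlarge : ¬ (A.natDegree = 0 ∧ B.natDegree = 0 ∧ D.natDegree = 0) := by
    rintro ⟨ha, hb, hd⟩
    have hfac : (4 * A * B * D - 1) * C = p * (A + B) := by linear_combination heq
    have hne : 4 * A * B * D - 1 ≠ 0 := by
      intro h
      rw [h, zero_mul] at hfac
      exact mul_ne_zero hp.ne_zero hAB0 hfac.symm
    rcases hp.prime.dvd_or_dvd (Dvd.intro _ hfac.symm) with h | h
    · have hle := natDegree_le_of_dvd h hne
      have hdeg : (4 * A * B * D - 1).natDegree = 0 := by
        rw [← C_1, natDegree_sub_C, natDegree_mul h4AB0 hD0,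
          natDegree_mul h4A0 hB0, natDegree_mul h40 hA0]
        omega
      omega
    · exact hndvd ((h.mul_left (A * B)).mul_right D)
  have hlinear : ¬ (A.natDegree = 1 ∧ B.natDegree = 1 ∧ C.natDegree = 0 ∧
      D.natDegree = 0) := by
    rintro ⟨ha, hb, hc, hd⟩
    refine not_linear_pair (N := 4 * C * D) hpdeg ha hb ?_ hC ?_ hc
      (by linear_combination heq)
    · rw [leadingCoeff_mul, leadingCoeff_mul, h4lead]
      positivity
    · rw [natDegree_mul (mul_ne_zero h40 hC0) hD0, natDegree_mul h40 hC0]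
      omega
  generalize A.natDegree = a at *
  generalize B.natDegree = b at *
  generalize C.natDegree = c at *
  generalize D.natDegree = d at *
  rcases le_or_gt c a with hca | hca
  · rw [max_eq_left (by omega)] at hsum
    have hbcd : (b = 1 ∧ c = 0 ∧ d = 0) ∨ (b = 0 ∧ c = 1 ∧ d = 0) ∨
        (b = 0 ∧ c = 0 ∧ d = 1) := by omega
    rcases hbcd with ⟨rfl, rfl, rfl⟩ | ⟨rfl, rfl, rfl⟩ | ⟨rfl, rfl, rfl⟩ <;> omega
  · rw [max_eq_right (by omega)] at hsum
    exact absurd ⟨by omega, by omega, by omega⟩ hlarge
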